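/- Equality of the two symmetric determinantal forms (from Theorem 4.1). Let N ≥ 1, let q, s_0 ∈ ℂ, let γ, ξ_0 ∈ ℂ∖{0}, let u_1,…,u_N be pairwise distinct nonzero complex numbers and v_1,…,v_N pairwise distinct nonzero complex numbers with u_iv_j ≠ 1 and qu_iv_j ≠ 1 for all i,j. Define M_i(v) = ξ_0^{2i−N} v^{N−i−1} [ (1−s_0ξ_0^{−1}v)(ξ_0^{−1}v−s_0) ∏_{l=1}^N (1−qvu_l)/(1−vu_l) − γ^{−1}q^{N−i}(γ−s_0ξ_0^{−1}v)(γqξ_0^{−1}v−s_0) ] and M̃_i(u) = u^{N−i−1} [ (1−s_0ξ_0u)(u−s_0ξ_0^{−1}) ∏_{l=1}^N (1−quv_l)/(1−uv_l) − γ^{−1}q^{N−i}(γ−s_0ξ_0u)(γqu−s_0ξ_0^{−1}) ]. Then det[M_i(v_j)]_{i,j=1}^N / ∏_{1≤i<j≤N}(v_i−v_j) = det[M̃_i(u_j)]_{i,j=1}^N / ∏_{1≤i<j≤N}(u_i−u_j). -/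

import Mathlib

open scoped BigOperators

noncomputable section

/-- The Vandermonde-type product `∏_{1 ≤ i < j ≤ N} (w i − w j)`. -/
def vandP {N : ℕ} (w : Fin N → ℂ) : ℂ :=
  ∏ p ∈ Finset.univ.filter (fun p : Fin N × Fin N => p.1 < p.2), (w p.1 - w p.2)

open Polynomial in
/-- The polynomial `∏_{l ≠ m} (1 - x_l X)`. -/
def coBasis {N : ℕ} (x : Fin N → ℂ) (m : Fin N) : ℂ[X] :=
  ∏ l ∈ Finset.univ.erase m, (1 - C (x l) * X)

/-- The coefficients of the polynomials `coBasis x m`, in decreasing order of degree. -/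
def coBasisMatrix {N : ℕ} (x : Fin N → ℂ) : Matrix (Fin N) (Fin N) ℂ :=
  Matrix.of fun m i => (coBasis x m).coeff (N - 1 - (i : ℕ))

lemma coBasis_eval {N : ℕ} (x : Fin N → ℂ) (m : Fin N) (t : ℂ) :
    (coBasis x m).eval t = ∏ l ∈ Finset.univ.erase m, (1 - x l * t) := by
  simp [coBasis, Polynomial.eval_prod]

lemma coBasis_natDegree_lt {N : ℕ} (x : Fin N → ℂ) (m : Fin N) :
    (coBasis x m).natDegree < N := by
  have h : (coBasis x m).natDegree ≤ ∑ l ∈ Finset.univ.erase m, 1 := by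
    refine (Polynomial.natDegree_prod_le _ _).trans (Finset.sum_le_sum fun l _ => ?_)
    compute_degree
  have hm := m.2
  simp at h
  omega

lemma sum_coBasisMatrix_mul_pow {N : ℕ} (x : Fin N → ℂ) (m : Fin N) (t : ℂ) :
    ∑ i : Fin N, coBasisMatrix x m i * t ^ (N - 1 - (i : ℕ))
      = ∏ l ∈ Finset.univ.erase m, (1 - x l * t) := by
  rw [← coBasis_eval, Polynomial.eval_eq_sum_range' (coBasis_natDegree_lt x m),
    ← Fin.sum_univ_eq_sum_range (fun k => (coBasis x m).coeff k * t ^ k),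
    ← Equiv.sum_comp Fin.revPerm]
  refine Finset.sum_congr rfl fun i _ => ?_
  have h : ((Fin.revPerm i : Fin N) : ℕ) = N - 1 - (i : ℕ) := by
    simp [Fin.val_rev]; omega
  have h' : N - 1 - (N - 1 - (i : ℕ)) = i := by omega
  simp only [h, h', coBasisMatrix, Matrix.of_apply]

lemma vandP_ne_zero {N : ℕ} {x : Fin N → ℂ} (hx : Function.Injective x) : vandP x ≠ 0 := by
  refine Finset.prod_ne_zero_iff.2 fun p hp => ?_
  rw [sub_ne_zero]
  exact fun h => (Finset.mem_filter.1 hp).2.ne (hx h)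

lemma det_vandermonde_eq_prod_filter {N : ℕ} (x : Fin N → ℂ) :
    (Matrix.vandermonde x).det
      = ∏ p ∈ Finset.univ.filter (fun p : Fin N × Fin N => p.1 < p.2), (x p.2 - x p.1) := by
  rw [Matrix.det_vandermonde, Finset.prod_filter, ← Finset.univ_product_univ,
    Finset.prod_product]
  refine Finset.prod_congr rfl fun i _ => ?_
  rw [← Finset.prod_filter]
  exact Finset.prod_congr (by ext; simp) fun _ _ => rfl

lemma vandP_eq_sign_mul_det {N : ℕ} (x : Fin N → ℂ) :
    vandP x = (-1) ^ (Finset.univ.filter (fun p : Fin N × Fin N => p.1 < p.2)).card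
      * (Matrix.vandermonde x).det := by
  rw [det_vandermonde_eq_prod_filter, ← Finset.prod_const, ← Finset.prod_mul_distrib]
  exact Finset.prod_congr rfl fun _ _ => by ring

lemma prod_prod_erase_sub {N : ℕ} (x : Fin N → ℂ) :
    ∏ m, ∏ l ∈ Finset.univ.erase m, (x m - x l)
      = vandP x * (Matrix.vandermonde x).det := by
  have h1 : ∀ m : Fin N, ∏ l ∈ Finset.univ.erase m, (x m - x l)
      = (∏ l, if m < l then x m - x l else 1) * ∏ l, if l < m then x m - x l else 1 := by
    intro m
    rw [← Finset.prod_mul_distrib, ← Finset.mul_prod_erase Finset.univ _ (Finset.mem_univ m)]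
    simp only [lt_irrefl, if_false, one_mul]
    refine Finset.prod_congr rfl fun l hl => ?_
    rcases lt_or_gt_of_ne (Finset.ne_of_mem_erase hl) with h | h <;> simp [h, h.not_gt]
  rw [Finset.prod_congr rfl fun m _ => h1 m, Finset.prod_mul_distrib,
    det_vandermonde_eq_prod_filter, vandP, Finset.prod_filter, Finset.prod_filter,
    ← Finset.univ_product_univ, Finset.prod_product, Finset.prod_product_right]

lemma det_coBasisMatrix {N : ℕ} {x : Fin N → ℂ} (hx : Function.Injective x)
    (hx0 : ∀ i, x i ≠ 0) : (coBasisMatrix x).det = vandP x := by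
  have hV : (Matrix.vandermonde x).det ≠ 0 := Matrix.det_vandermonde_ne_zero_iff.2 hx
  refine mul_right_cancel₀ hV ?_
  rw [← prod_prod_erase_sub, ← Matrix.det_transpose (Matrix.vandermonde x), ← Matrix.det_mul,
    ← Matrix.det_diagonal]
  congr 1
  ext m j
  have hsum : (coBasisMatrix x * (Matrix.vandermonde x).transpose) m j
      = x j ^ (N - 1) * ∏ l ∈ Finset.univ.erase m, (1 - x l * (x j)⁻¹) := by
    rw [← sum_coBasisMatrix_mul_pow, Finset.mul_sum, Matrix.mul_apply]
    refine Finset.sum_congr rfl fun i _ => ?_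
    have hi : N - 1 = (N - 1 - (i : ℕ)) + i := by omega
    have hp : x j ^ (N - 1) = x j ^ (N - 1 - (i : ℕ)) * x j ^ (i : ℕ) := by
      rw [← pow_add, ← hi]
    rw [Matrix.transpose_apply, Matrix.vandermonde_apply, hp, inv_pow]
    field_simp [hx0 j]
  rw [hsum]
  by_cases hmj : m = j
  · subst hmj
    have hc : (Finset.univ.erase m).card = N - 1 := by simp
    rw [Matrix.diagonal_apply_eq, ← hc, ← Finset.prod_const, ← Finset.prod_mul_distrib]
    refine Finset.prod_congr rfl fun l _ => ?_
    field_simp [hx0 m]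
  · rw [Matrix.diagonal_apply_ne _ hmj]
    refine mul_eq_zero_of_right _ (Finset.prod_eq_zero (i := j) ?_ ?_)
    · simp [Ne.symm hmj]
    · simp [hx0 j]

/-- The matrix of the determinantal form at `ξ₀ = 1`. -/
def formMatrix {N : ℕ} (q s γ : ℂ) (w x : Fin N → ℂ) : Matrix (Fin N) (Fin N) ℂ :=
  Matrix.of fun i j => (w j)⁻¹ * w j ^ (N - 1 - (i : ℕ))
    * ((1 - s * w j) * (w j - s) * ∏ l, (1 - q * w j * x l) / (1 - w j * x l)
      - γ⁻¹ * q ^ (N - 1 - (i : ℕ)) * (γ - s * w j) * (γ * q * w j - s))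

/-- The kernel to which the determinantal form reduces. -/
def formKernel (q s γ w x : ℂ) : ℂ :=
  w⁻¹ * ((1 - s * w) * (w - s) / (1 - w * x)
    - γ⁻¹ * (γ - s * w) * (γ * q * w - s) / (1 - q * w * x))

lemma formKernel_comm {q s γ w x : ℂ} (hγ : γ ≠ 0) (hw : w ≠ 0) (hx : x ≠ 0)
    (h1 : w * x ≠ 1) (h2 : q * w * x ≠ 1) : formKernel q s γ w x = formKernel q s γ x w := by
  have e1 : 1 - w * x ≠ 0 := sub_ne_zero.2 h1.symm
  have e2 : 1 - q * w * x ≠ 0 := sub_ne_zero.2 h2.symm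
  have e3 : 1 - x * w = 1 - w * x := by ring
  have e4 : 1 - q * x * w = 1 - q * w * x := by ring
  rw [formKernel, formKernel, e3, e4]
  generalize hD : 1 - w * x = D at e1
  generalize hE : 1 - q * w * x = E at e2
  field_simp
  subst hD hE
  ring

lemma coBasisMatrix_mul_formMatrix {N : ℕ} (q s γ : ℂ) {w x : Fin N → ℂ}
    (h1 : ∀ i j, w i * x j ≠ 1) (h2 : ∀ i j, q * w i * x j ≠ 1) :
    coBasisMatrix x * formMatrix q s γ w x
      = Matrix.of fun m j => (∏ l, (1 - q * w j * x l)) * formKernel q s γ (w j) (x m) := by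
  ext m j
  have hsum : (coBasisMatrix x * formMatrix q s γ w x) m j
      = (w j)⁻¹ * ((1 - s * w j) * (w j - s) * (∏ l, (1 - q * w j * x l) / (1 - w j * x l))
          * (∑ i : Fin N, coBasisMatrix x m i * w j ^ (N - 1 - (i : ℕ)))
        - γ⁻¹ * (γ - s * w j) * (γ * q * w j - s)
          * ∑ i : Fin N, coBasisMatrix x m i * (q * w j) ^ (N - 1 - (i : ℕ))) := by
    rw [Matrix.mul_apply, Finset.mul_sum, Finset.mul_sum, ← Finset.sum_sub_distrib,
      Finset.mul_sum]
    refine Finset.sum_congr rfl fun i _ => ?_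
    rw [formMatrix, Matrix.of_apply, mul_pow]
    ring
  have g1 : ∀ l, 1 - w j * x l ≠ 0 := fun l => sub_ne_zero.2 (h1 j l).symm
  have g2 : ∀ l, 1 - q * w j * x l ≠ 0 := fun l => sub_ne_zero.2 (h2 j l).symm
  have p1 : ∏ l, (1 - w j * x l)
      = (1 - w j * x m) * ∏ l ∈ Finset.univ.erase m, (1 - x l * w j) := by
    rw [← Finset.mul_prod_erase Finset.univ _ (Finset.mem_univ m)]
    exact congrArg _ (Finset.prod_congr rfl fun l _ => by ring)
  have p2 : ∏ l, (1 - q * w j * x l)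
      = (1 - q * w j * x m) * ∏ l ∈ Finset.univ.erase m, (1 - x l * (q * w j)) := by
    rw [← Finset.mul_prod_erase Finset.univ _ (Finset.mem_univ m)]
    exact congrArg _ (Finset.prod_congr rfl fun l _ => by ring)
  have n1 : ∏ l ∈ Finset.univ.erase m, (1 - x l * w j) ≠ 0 :=
    Finset.prod_ne_zero_iff.2 fun l _ => by rw [mul_comm]; exact g1 l
  rw [hsum, sum_coBasisMatrix_mul_pow, sum_coBasisMatrix_mul_pow, Finset.prod_div_distrib,
    Matrix.of_apply, formKernel, p1, p2]
  have g1m := g1 m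
  have g2m := g2 m
  generalize ∏ l ∈ Finset.univ.erase m, (1 - x l * w j) = A at *
  generalize ∏ l ∈ Finset.univ.erase m, (1 - x l * (q * w j)) = B at *
  generalize hD : 1 - w j * x m = D at *
  generalize hE : 1 - q * w j * x m = E at *
  generalize (w j)⁻¹ = w' at *
  generalize γ⁻¹ = γ' at *
  field_simp

lemma vandP_mul_det_formMatrix {N : ℕ} (q s γ : ℂ) {w x : Fin N → ℂ}
    (hx : Function.Injective x) (hx0 : ∀ i, x i ≠ 0)
    (h1 : ∀ i j, w i * x j ≠ 1) (h2 : ∀ i j, q * w i * x j ≠ 1) :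
    vandP x * (formMatrix q s γ w x).det
      = (∏ j, ∏ l, (1 - q * w j * x l))
        * (Matrix.of fun m j => formKernel q s γ (w j) (x m)).det := by
  rw [← det_coBasisMatrix hx hx0, ← Matrix.det_mul, coBasisMatrix_mul_formMatrix q s γ h1 h2,
    ← Matrix.det_mul_row]
  rfl

lemma vandP_mul_det_formMatrix_comm {N : ℕ} {q s γ : ℂ} (hγ : γ ≠ 0) {w x : Fin N → ℂ}
    (hw : Function.Injective w) (hx : Function.Injective x)
    (hw0 : ∀ i, w i ≠ 0) (hx0 : ∀ i, x i ≠ 0)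
    (h1 : ∀ i j, w i * x j ≠ 1) (h2 : ∀ i j, q * w i * x j ≠ 1) :
    vandP x * (formMatrix q s γ w x).det = vandP w * (formMatrix q s γ x w).det := by
  rw [vandP_mul_det_formMatrix q s γ hx hx0 h1 h2,
    vandP_mul_det_formMatrix q s γ hw hw0 (fun i j => by rw [mul_comm]; exact h1 j i)
      (fun i j => by rw [mul_right_comm]; exact h2 j i), Finset.prod_comm,
    ← Matrix.det_transpose]
  congr 1
  · exact Finset.prod_congr rfl fun _ _ => Finset.prod_congr rfl fun _ _ => by ring
  · congr 1
    ext i j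
    exact formKernel_comm hγ (hw0 i) (hx0 j) (h1 i j) (h2 i j)

lemma vandP_const_mul {N : ℕ} (c : ℂ) (w : Fin N → ℂ) :
    vandP (fun i => c * w i) = (∏ i : Fin N, c ^ (i : ℕ)) * vandP w := by
  have h : Matrix.vandermonde (fun i => c * w i)
      = Matrix.of fun i j : Fin N => c ^ (j : ℕ) * Matrix.vandermonde w i j := by
    ext i j
    simp [Matrix.vandermonde_apply, mul_pow]
  rw [vandP_eq_sign_mul_det, vandP_eq_sign_mul_det, h, Matrix.det_mul_row]
  ring

lemma prod_pow_rev {N : ℕ} (c : ℂ) :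
    ∏ i : Fin N, c ^ (N - 1 - (i : ℕ)) = ∏ i : Fin N, c ^ (i : ℕ) := by
  rw [← Equiv.prod_comp Fin.revPerm]
  refine Finset.prod_congr rfl fun i _ => ?_
  congr 1
  simp [Fin.val_rev]
  omega

/-- Equality of the two symmetric determinantal forms (from Theorem 4.1). -/
theorem equality_of_symmetric_det_forms
    (N : ℕ) (hN : 1 ≤ N) (q s0 : ℂ) (γ ξ0 : ℂ) (hγ : γ ≠ 0) (hξ : ξ0 ≠ 0)
    (u v : Fin N → ℂ) (hu : Function.Injective u) (hv : Function.Injective v)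
    (hu0 : ∀ i, u i ≠ 0) (hv0 : ∀ j, v j ≠ 0)
    (huv : ∀ i j : Fin N, u i * v j ≠ 1) (hquv : ∀ i j : Fin N, q * u i * v j ≠ 1) :
    Matrix.det (Matrix.of fun i j : Fin N =>
        ξ0 ^ (2 * ((i : ℕ) : ℤ) + 2 - (N : ℤ)) * v j ^ ((N : ℤ) - (i : ℕ) - 2)
          * ((1 - s0 * ξ0⁻¹ * v j) * (ξ0⁻¹ * v j - s0)
                * ∏ l : Fin N, (1 - q * v j * u l) / (1 - v j * u l)
              - γ⁻¹ * q ^ (N - 1 - (i : ℕ)) * (γ - s0 * ξ0⁻¹ * v j)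
                * (γ * q * ξ0⁻¹ * v j - s0)))
      / vandP v
    = Matrix.det (Matrix.of fun i j : Fin N =>
        u j ^ ((N : ℤ) - (i : ℕ) - 2)
          * ((1 - s0 * ξ0 * u j) * (u j - s0 * ξ0⁻¹)
                * ∏ l : Fin N, (1 - q * u j * v l) / (1 - u j * v l)
              - γ⁻¹ * q ^ (N - 1 - (i : ℕ)) * (γ - s0 * ξ0 * u j)
                * (γ * q * u j - s0 * ξ0⁻¹)))
      / vandP u := by
  have hz : ∀ (z : ℂ) (i : Fin N), z ≠ 0 →
      z ^ ((N : ℤ) - (i : ℕ) - 2) = z⁻¹ * z ^ (N - 1 - (i : ℕ)) := by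
    intro z i h
    have e : (N : ℤ) - (i : ℕ) - 2 = -1 + ((N - 1 - (i : ℕ) : ℕ) : ℤ) := by omega
    rw [e, zpow_add₀ h, zpow_neg_one, zpow_natCast]
  set w : Fin N → ℂ := fun j => ξ0⁻¹ * v j with hw
  set x : Fin N → ℂ := fun j => ξ0 * u j with hx
  have hv' : v = fun j => ξ0 * w j := by
    ext j; simp [hw, hξ]
  have hu' : u = fun j => ξ0⁻¹ * x j := by
    ext j; simp [hx, hξ]
  have hwx : ∀ i j, w i * x j = u j * v i := fun i j => by
    simp only [hw, hx]; field_simp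
  have hL : (Matrix.of fun i j : Fin N =>
        ξ0 ^ (2 * ((i : ℕ) : ℤ) + 2 - (N : ℤ)) * v j ^ ((N : ℤ) - (i : ℕ) - 2)
          * ((1 - s0 * ξ0⁻¹ * v j) * (ξ0⁻¹ * v j - s0)
                * ∏ l : Fin N, (1 - q * v j * u l) / (1 - v j * u l)
              - γ⁻¹ * q ^ (N - 1 - (i : ℕ)) * (γ - s0 * ξ0⁻¹ * v j)
                * (γ * q * ξ0⁻¹ * v j - s0)))
      = Matrix.of fun i j : Fin N => ξ0 ^ (i : ℕ) * formMatrix q s0 γ w x i j := by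
    ext i j
    have hp : ∏ l : Fin N, (1 - q * v j * u l) / (1 - v j * u l)
        = ∏ l : Fin N, (1 - q * w j * x l) / (1 - w j * x l) :=
      Finset.prod_congr rfl fun l _ => by
        rw [mul_assoc q (w j), hwx]; ring
    have hq : ξ0 ^ (2 * ((i : ℕ) : ℤ) + 2 - (N : ℤ)) * v j ^ ((N : ℤ) - (i : ℕ) - 2)
        = ξ0 ^ (i : ℕ) * ((w j)⁻¹ * w j ^ (N - 1 - (i : ℕ))) := by
      have e : 2 * ((i : ℕ) : ℤ) + 2 - (N : ℤ) = (i : ℕ) + -((N : ℤ) - (i : ℕ) - 2) := by ring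
      rw [← hz _ _ (mul_ne_zero (inv_ne_zero hξ) (hv0 j)), mul_zpow, inv_zpow', e,
        zpow_add₀ hξ, zpow_natCast, mul_assoc]
    simp only [Matrix.of_apply, formMatrix]
    rw [hp, hq]
    simp only [hw]
    ring
  have hR : (Matrix.of fun i j : Fin N =>
        u j ^ ((N : ℤ) - (i : ℕ) - 2)
          * ((1 - s0 * ξ0 * u j) * (u j - s0 * ξ0⁻¹)
                * ∏ l : Fin N, (1 - q * u j * v l) / (1 - u j * v l)
              - γ⁻¹ * q ^ (N - 1 - (i : ℕ)) * (γ - s0 * ξ0 * u j)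
                * (γ * q * u j - s0 * ξ0⁻¹)))
      = Matrix.of fun i j : Fin N =>
        ξ0⁻¹ ^ (N - 1 - (i : ℕ)) * formMatrix q s0 γ x w i j := by
    ext i j
    have hp : ∏ l : Fin N, (1 - q * u j * v l) / (1 - u j * v l)
        = ∏ l : Fin N, (1 - q * x j * w l) / (1 - x j * w l) :=
      Finset.prod_congr rfl fun l _ => by
        rw [mul_assoc q (x j), mul_comm (x j), hwx]; ring
    have hc : ξ0⁻¹ * ξ0 = 1 := inv_mul_cancel₀ hξ
    have e1 : u j - s0 * ξ0⁻¹ = ξ0⁻¹ * (x j - s0) := by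
      simp only [hx]; linear_combination (-u j) * hc
    have e2 : γ * q * u j - s0 * ξ0⁻¹ = ξ0⁻¹ * (γ * q * x j - s0) := by
      simp only [hx]; linear_combination (-γ * q * u j) * hc
    have e3 : s0 * ξ0 * u j = s0 * x j := by simp only [hx]; ring
    have e4 : (u j)⁻¹ * u j ^ (N - 1 - (i : ℕ)) * ξ0⁻¹
        = ξ0⁻¹ ^ (N - 1 - (i : ℕ)) * ((x j)⁻¹ * x j ^ (N - 1 - (i : ℕ))) := by
      simp only [hx, mul_pow, mul_inv, inv_pow]
      field_simp
    simp only [Matrix.of_apply, formMatrix]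
    rw [hp, hz _ _ (hu0 j), e1, e2, e3]
    linear_combination ((1 - s0 * x j) * (x j - s0)
        * ∏ l, (1 - q * x j * w l) / (1 - x j * w l)
      - γ⁻¹ * q ^ (N - 1 - (i : ℕ)) * (γ - s0 * x j) * (γ * q * x j - s0)) * e4
  have hw0 : ∀ j, w j ≠ 0 := fun j => mul_ne_zero (inv_ne_zero hξ) (hv0 j)
  have hx0 : ∀ j, x j ≠ 0 := fun j => mul_ne_zero hξ (hu0 j)
  have hwi : Function.Injective w := (mul_right_injective₀ (inv_ne_zero hξ)).comp hv
  have hxi : Function.Injective x := (mul_right_injective₀ hξ).comp hu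
  have key := vandP_mul_det_formMatrix_comm (q := q) (s := s0) hγ hwi hxi hw0 hx0
    (fun i j => by rw [hwx]; exact huv j i)
    (fun i j => by rw [mul_assoc, hwx, ← mul_assoc]; exact hquv j i)
  have hvP : vandP v = (∏ i : Fin N, ξ0 ^ (i : ℕ)) * vandP w := by
    rw [← vandP_const_mul, ← hv']
  have huP : vandP u = (∏ i : Fin N, ξ0⁻¹ ^ (i : ℕ)) * vandP x := by
    rw [← vandP_const_mul, ← hu']
  have c1 : ∏ i : Fin N, ξ0 ^ (i : ℕ) ≠ 0 :=
    Finset.prod_ne_zero_iff.2 fun i _ => pow_ne_zero _ hξ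
  have c2 : ∏ i : Fin N, ξ0⁻¹ ^ (i : ℕ) ≠ 0 :=
    Finset.prod_ne_zero_iff.2 fun i _ => pow_ne_zero _ (inv_ne_zero hξ)
  rw [hL, hR, Matrix.det_mul_column, Matrix.det_mul_column, prod_pow_rev, hvP, huP,
    mul_div_mul_left _ _ c1, mul_div_mul_left _ _ c2,
    div_eq_div_iff (vandP_ne_zero hwi) (vandP_ne_zero hxi), mul_comm, key, mul_comm]
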